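/- arXiv:1509.01456 — 2 statements merged into one kernel-verified Lean document; each statement's English description precedes it below -/
import Mathlib

section
/- Let u and v be fuzzy numbers and let α ∈ [0,1]. If the right derivative v'₊(v⁻(α)) = 0 and v(v⁻(α)) = β, then the right derivative of u∇v at (u∇v)⁻(β) equals 0, i.e., (u∇v)'₊((u∇v)⁻(β)) = 0. -/
open Set Filter Topology

/-- A fuzzy number: a function `ℝ → ℝ` taking values in `[0,1]`, whose `α`-cuts
(for `α ∈ (0,1]`) and whose `0`-cut (the closure of the support) are nonempty
compact intervals. -/
structure FuzzyNumber where
  f : ℝ → ℝ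
  mem_Icc : ∀ x, f x ∈ Set.Icc (0 : ℝ) 1
  cut_isIcc : ∀ α ∈ Set.Ioc (0 : ℝ) 1, ∃ a b : ℝ, a ≤ b ∧ {x | α ≤ f x} = Set.Icc a b
  supp_isIcc : ∃ a b : ℝ, a ≤ b ∧ closure {x | 0 < f x} = Set.Icc a b

namespace FuzzyNumber

/-- The `α`-cut of a fuzzy number; for `α = 0` it is the closure of the support. -/
noncomputable def cut (u : FuzzyNumber) (α : ℝ) : Set ℝ :=
  if α = 0 then closure {x | 0 < u.f x} else {x | α ≤ u.f x}

/-- Left endpoint `u⁻(α)` of the `α`-cut. -/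
noncomputable def lo (u : FuzzyNumber) (α : ℝ) : ℝ := sInf (u.cut α)

/-- Right endpoint `u⁺(α)` of the `α`-cut. -/
noncomputable def hi (u : FuzzyNumber) (α : ℝ) : ℝ := sSup (u.cut α)

/-- Left endpoint `u_s⁻(α)` of the strong `α`-cut: `lim_{β→α⁺} u⁻(β)` for `α < 1`,
and `u⁻(1)` for `α = 1`.  Since `u⁻` is nondecreasing, this right limit is the
infimum of `u⁻` over `(α,1]`. -/
noncomputable def slo (u : FuzzyNumber) (α : ℝ) : ℝ :=
  if α < 1 then sInf (u.lo '' Set.Ioc α 1) else u.lo 1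

/-- Right endpoint `u_s⁺(α)` of the strong `α`-cut: `lim_{β→α⁺} u⁺(β)` for `α < 1`,
and `u⁺(1)` for `α = 1`. -/
noncomputable def shi (u : FuzzyNumber) (α : ℝ) : ℝ :=
  if α < 1 then sSup (u.hi '' Set.Ioc α 1) else u.hi 1

/-- The sup-min convolution `u∇v` of two fuzzy numbers, as a function on `ℝ`:
`(u∇v)(x) = sup_y min (u y) (v (x - y))`.  Its cut functions satisfy
`(u∇v)⁻(α) = u⁻(α) + v⁻(α)` and `(u∇v)⁺(α) = u⁺(α) + v⁺(α)`. -/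
noncomputable def conv (u v : FuzzyNumber) (x : ℝ) : ℝ :=
  ⨆ y : ℝ, min (u.f y) (v.f (x - y))

end FuzzyNumber

/-- `f` has left derivative `f'` at `x`. -/
def HasLeftDerivAt (f : ℝ → ℝ) (f' x : ℝ) : Prop :=
  HasDerivWithinAt f f' (Set.Iio x) x

/-- `f` has right derivative `f'` at `x`. -/
def HasRightDerivAt (f : ℝ → ℝ) (f' x : ℝ) : Prop :=
  HasDerivWithinAt f f' (Set.Ioi x) x

namespace FuzzyNumber

lemma exists_cut_eq_Icc (u : FuzzyNumber) {α : ℝ} (hα : α ∈ Set.Icc (0 : ℝ) 1) :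
    ∃ a b : ℝ, a ≤ b ∧ u.cut α = Set.Icc a b := by
  unfold cut
  split_ifs with h
  · exact u.supp_isIcc
  · exact u.cut_isIcc α ⟨lt_of_le_of_ne hα.1 (Ne.symm h), hα.2⟩

lemma lo_le (u : FuzzyNumber) {α y : ℝ} (hα : 0 ≤ α) (hy : α ≤ u.f y) (hpos : 0 < u.f y) :
    u.lo α ≤ y := by
  obtain ⟨a, b, -, hcut⟩ := u.exists_cut_eq_Icc ⟨hα, hy.trans (u.mem_Icc y).2⟩
  refine csInf_le (hcut ▸ bddBelow_Icc) ?_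
  unfold cut
  split_ifs
  · exact subset_closure hpos
  · exact hy

lemma le_f_lo (u : FuzzyNumber) {α : ℝ} (hα : α ∈ Set.Icc (0 : ℝ) 1) : α ≤ u.f (u.lo α) := by
  rcases hα.1.eq_or_lt with rfl | hpos
  · exact (u.mem_Icc _).1
  · obtain ⟨a, b, hab, hcut⟩ := u.exists_cut_eq_Icc hα
    have hlo : u.lo α ∈ u.cut α := by
      rw [lo, hcut, csInf_Icc hab]
      exact left_mem_Icc.2 hab
    rwa [cut, if_neg hpos.ne'] at hlo

lemma lo_f_lo (u : FuzzyNumber) {α : ℝ} (hα : α ∈ Set.Icc (0 : ℝ) 1) :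
    u.lo (u.f (u.lo α)) = u.lo α := by
  have hle := u.le_f_lo hα
  rcases (u.mem_Icc (u.lo α)).1.eq_or_lt with h0 | hpos
  · rw [← h0, le_antisymm (h0 ▸ hle) hα.1]
  · have hle' := u.le_f_lo (u.mem_Icc (u.lo α))
    exact le_antisymm (u.lo_le hpos.le le_rfl hpos)
      (u.lo_le hα.1 (hle.trans hle') (hpos.trans_le hle'))

lemma min_le_conv (u v : FuzzyNumber) (x y : ℝ) : min (u.f y) (v.f (x - y)) ≤ u.conv v x :=
  le_ciSup (f := fun y => min (u.f y) (v.f (x - y)))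
    ⟨1, by rintro _ ⟨z, rfl⟩; exact (min_le_left _ _).trans (u.mem_Icc z).2⟩ y

/-- A bound on `v` just to the right of `v⁻(β)` carries over to `u∇v`. -/
lemma conv_le (u v : FuzzyNumber) {β h c : ℝ} (hβ : 0 ≤ β) (hβc : β ≤ c)
    (hvβ : v.f (v.lo β) ≤ β) (hc : ∀ z ∈ Set.Ioc (v.lo β) (v.lo β + h), v.f z ≤ c) :
    u.conv v (u.lo β + v.lo β + h) ≤ c := by
  refine ciSup_le fun y => ?_
  by_contra! hlt
  obtain ⟨huy, hvz⟩ := lt_min_iff.1 hlt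
  have hy := u.lo_le hβ (hβc.trans huy.le) (by linarith)
  have hz := v.lo_le hβ (hβc.trans hvz.le) (by linarith)
  have hne : v.lo β ≠ u.lo β + v.lo β + h - y := fun he => by
    rw [← he] at hvz
    linarith
  exact hvz.not_ge (hc _ ⟨lt_of_le_of_ne hz hne, by linarith⟩)

lemma min_le_conv_lo_add (u v : FuzzyNumber) {β : ℝ} (hβ : β ∈ Set.Icc (0 : ℝ) 1) (h : ℝ) :
    min β (v.f (v.lo β + h)) ≤ u.conv v (u.lo β + v.lo β + h) := by
  refine le_trans ?_ (u.min_le_conv v _ (u.lo β))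
  rw [show u.lo β + v.lo β + h - u.lo β = v.lo β + h by ring]
  exact min_le_min_right _ (u.le_f_lo hβ)

end FuzzyNumber

/-- Theorem `dzeron`(ii): if `v'₊(v⁻(α)) = 0` and `v(v⁻(α)) = β`,
then `(u∇v)'₊((u∇v)⁻(β)) = 0`. -/
theorem conv_rightDeriv_zero (u v : FuzzyNumber) (α β : ℝ) (hα : α ∈ Set.Icc (0 : ℝ) 1)
    (hv : HasRightDerivAt v.f 0 (v.lo α)) (hβ : v.f (v.lo α) = β) :
    HasRightDerivAt (u.conv v) 0 (u.lo β + v.lo β) := by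
  have hβ01 : β ∈ Set.Icc (0 : ℝ) 1 := hβ ▸ v.mem_Icc _
  have hlo : v.lo β = v.lo α := by rw [← hβ, v.lo_f_lo hα]
  rw [← hlo] at hv hβ
  have hp : u.conv v (u.lo β + v.lo β) = β := by
    apply le_antisymm
    · simpa using u.conv_le v (h := 0) hβ01.1 le_rfl hβ.le (by simp)
    · simpa [hβ] using u.min_le_conv_lo_add v hβ01 0
  unfold HasRightDerivAt at hv ⊢
  rw [hasDerivWithinAt_iff_isLittleO, Asymptotics.isLittleO_iff] at hv ⊢
  intro c hc
  obtain ⟨d, hd, hsub⟩ := mem_nhdsGT_iff_exists_Ioo_subset.1 (hv hc)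
  have hbound : ∀ z ∈ Set.Ioo (v.lo β) d, |v.f z - β| ≤ c * (z - v.lo β) := fun z hz => by
    simpa [hβ, abs_of_pos (sub_pos.2 hz.1)] using hsub hz
  have hd' : u.lo β + v.lo β < u.lo β + d := by linarith [Set.mem_Ioi.1 hd]
  filter_upwards [Ioo_mem_nhdsGT hd'] with x hx
  obtain ⟨h, rfl⟩ : ∃ h, x = u.lo β + v.lo β + h := ⟨x - (u.lo β + v.lo β), by ring⟩
  have hh : 0 < h := by linarith [hx.1]
  have hhd : v.lo β + h < d := by linarith [hx.2]
  have hupper : u.conv v (u.lo β + v.lo β + h) ≤ β + c * h := by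
    refine u.conv_le v hβ01.1 (by nlinarith) hβ.le fun z hz => ?_
    have hzb := (abs_le.1 (hbound z ⟨hz.1, hz.2.trans_lt hhd⟩)).2
    nlinarith [hz.2]
  have hlower : β - c * h ≤ u.conv v (u.lo β + v.lo β + h) := by
    refine le_trans (le_min (by nlinarith) ?_) (u.min_le_conv_lo_add v hβ01 h)
    have hvb := (abs_le.1 (hbound (v.lo β + h) ⟨by linarith, hhd⟩)).1
    rw [add_sub_cancel_left] at hvb
    linarith
  rw [hp, smul_zero, sub_zero, add_sub_cancel_left, Real.norm_eq_abs, Real.norm_eq_abs,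
    abs_of_pos hh, abs_le]
  constructor <;> linarith
end

section
/- Suppose u ∈ F_C(ℝ) and w ∈ F_D(ℝ), and suppose w satisfies: (i) w(w⁻(0)) = u(u⁻(0)) and w(w⁺(0)) = u(u⁺(0)); (ii-1) if u⁻(1) is an interior point of [u]_0 at which u is not differentiable, then w'₋(w⁻(1)) = 0; (ii-2) if u⁺(1) is an interior point of [u]_0 at which u is not differentiable, then w'₊(w⁺(1)) = 0; and (iv) for every point x ∈ (u⁻(0), u⁺(0)) at which u is not differentiable: if u⁻(0) < x < u⁻(1) then w'₊(w⁻(u(x))) = 0, and if u⁺(1) < x < u⁺(0) then w'₋(w⁺(u(x))) = 0. Then u∇w ∈ F_D(ℝ). -/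
open Set Filter Topology

theorem HasDerivWithinAt.of_min_le_of_le_max {A B V : ℝ → ℝ} {d x : ℝ} {s : Set ℝ}
    (hA : HasDerivWithinAt A d s x) (hB : HasDerivWithinAt B d s x)
    (hAV : A x = V x) (hBV : B x = V x)
    (h : ∀ᶠ x' in 𝓝[s] x, min (A x') (B x') ≤ V x' ∧ V x' ≤ max (A x') (B x')) :
    HasDerivWithinAt V d s x := by
  rw [hasDerivWithinAt_iff_isLittleO] at hA hB ⊢
  refine Asymptotics.IsBigO.trans_isLittleO ?_ (hA.norm_left.add hB.norm_left)
  refine Asymptotics.IsBigO.of_bound 1 ?_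
  filter_upwards [h] with x' hx'
  have h0 : 0 ≤ ‖A x' - A x - (x' - x) • d‖ + ‖B x' - B x - (x' - x) • d‖ := by positivity
  rw [one_mul, Real.norm_of_nonneg h0]
  simp only [Real.norm_eq_abs, hAV, hBV]
  have h1 := abs_nonneg (A x' - V x - (x' - x) • d)
  have h2 := abs_nonneg (B x' - V x - (x' - x) • d)
  have h3 := le_abs_self (A x' - V x - (x' - x) • d)
  have h4 := le_abs_self (B x' - V x - (x' - x) • d)
  have h5 := neg_abs_le (A x' - V x - (x' - x) • d)
  have h6 := neg_abs_le (B x' - V x - (x' - x) • d)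
  obtain ⟨hl, hr⟩ := hx'
  rw [abs_le]
  constructor
  · rcases min_le_iff.1 hl with h | h <;> linarith
  · rcases le_max_iff.1 hr with h | h <;> linarith

theorem DifferentiableAt.hasDerivAt_zero_of_hasDerivWithinAt {f : ℝ → ℝ} {s : Set ℝ} {x : ℝ}
    (hf : DifferentiableAt ℝ f x) (hs : UniqueDiffWithinAt ℝ s x)
    (h : HasDerivWithinAt f 0 s x) : HasDerivAt f 0 x := by
  have := hs.eq_deriv s hf.hasDerivAt.hasDerivWithinAt h
  exact this ▸ hf.hasDerivAt

theorem hasDerivWithinAt_Iic_zero_of_const {f : ℝ → ℝ} {a x : ℝ} (hax : a < x)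
    (h : ∀ y ∈ Icc a x, f y = f x) : HasDerivWithinAt f 0 (Iic x) x := by
  refine (hasDerivWithinAt_const x (Iic x) (f x)).congr_of_eventuallyEq ?_ rfl
  have h1 : ∀ᶠ y in 𝓝[Iic x] x, a < y := mem_nhdsWithin_of_mem_nhds (Ioi_mem_nhds hax)
  filter_upwards [h1, self_mem_nhdsWithin] with y hy hy'
  exact h y ⟨hy.le, hy'⟩

theorem HasDerivWithinAt.comp_neg_Iio {f : ℝ → ℝ} {x : ℝ}
    (h : HasDerivWithinAt f 0 (Ioi x) x) :
    HasDerivWithinAt (fun y => f (-y)) 0 (Iio (-x)) (-x) := by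
  have h' : HasDerivWithinAt f 0 (Ioi x) (-(-x)) := by rwa [neg_neg]
  have := h'.comp (-x) (h := fun y : ℝ => -y) (s := Iio (-x))
    (hasDerivAt_neg (-x)).hasDerivWithinAt (fun y hy => lt_neg_of_lt_neg (mem_Iio.1 hy))
  rwa [zero_mul] at this

theorem HasDerivWithinAt.comp_neg_Ioi {f : ℝ → ℝ} {x : ℝ}
    (h : HasDerivWithinAt f 0 (Iio x) x) :
    HasDerivWithinAt (fun y => f (-y)) 0 (Ioi (-x)) (-x) := by
  have h' : HasDerivWithinAt f 0 (Iio x) (-(-x)) := by rwa [neg_neg]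
  have := h'.comp (-x) (h := fun y : ℝ => -y) (s := Ioi (-x))
    (hasDerivAt_neg (-x)).hasDerivWithinAt (fun y hy => neg_lt.1 (mem_Ioi.1 hy))
  rwa [zero_mul] at this

namespace FuzzyNumber

variable (u w : FuzzyNumber)

theorem cut_zero : u.cut 0 = Icc (u.lo 0) (u.hi 0) ∧ u.lo 0 ≤ u.hi 0 := by
  obtain ⟨a, b, hab, h⟩ := u.supp_isIcc
  have : u.cut 0 = Icc a b := by simp [cut, h]
  simp [lo, hi, this, csInf_Icc hab, csSup_Icc hab, hab]

theorem cut_pos {α : ℝ} (h0 : 0 < α) (h1 : α ≤ 1) :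
    {x | α ≤ u.f x} = Icc (u.lo α) (u.hi α) ∧ u.lo α ≤ u.hi α := by
  obtain ⟨a, b, hab, h⟩ := u.cut_isIcc α ⟨h0, h1⟩
  have : u.cut α = Icc a b := by simp [cut, h, h0.ne']
  simp [lo, hi, this, csInf_Icc hab, csSup_Icc hab, hab, h]

theorem le_iff {α : ℝ} (h0 : 0 < α) (h1 : α ≤ 1) (x : ℝ) :
    α ≤ u.f x ↔ x ∈ Icc (u.lo α) (u.hi α) := by
  rw [← (u.cut_pos h0 h1).1, mem_ofPred_eq]

theorem mem_supp {x : ℝ} (h : 0 < u.f x) : x ∈ Icc (u.lo 0) (u.hi 0) := by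
  rw [← u.cut_zero.1, cut, if_pos rfl]
  exact subset_closure h

theorem nonneg (x : ℝ) : 0 ≤ u.f x := (u.mem_Icc x).1

theorem le_one (x : ℝ) : u.f x ≤ 1 := (u.mem_Icc x).2

theorem lo_one_le_hi_one : u.lo 1 ≤ u.hi 1 := (u.cut_pos one_pos le_rfl).2

theorem eq_one_iff (x : ℝ) : u.f x = 1 ↔ x ∈ Icc (u.lo 1) (u.hi 1) := by
  rw [← u.le_iff one_pos le_rfl]
  exact ⟨fun h => h.ge, fun h => le_antisymm (u.le_one x) h⟩

theorem lo_one : u.f (u.lo 1) = 1 := (u.eq_one_iff _).2 ⟨le_rfl, u.lo_one_le_hi_one⟩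

theorem lo_zero_le_lo_one : u.lo 0 ≤ u.lo 1 :=
  (u.mem_supp (by rw [u.lo_one]; exact one_pos)).1

theorem lo_one_le_hi_zero : u.lo 1 ≤ u.hi 0 :=
  (u.mem_supp (by rw [u.lo_one]; exact one_pos)).2

theorem monotoneOn : MonotoneOn u.f (Iic (u.lo 1)) := by
  intro x _ y hy hxy
  rcases (u.nonneg x).eq_or_lt with h | h
  · rw [← h]; exact u.nonneg y
  · have h1 := u.le_one x
    have hc := (u.le_iff h h1 (u.lo 1)).1 (by rw [u.lo_one]; exact h1)
    exact (u.le_iff h h1 y).2 ⟨((u.le_iff h h1 x).1 le_rfl).1.trans hxy, le_trans hy hc.2⟩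

theorem lt_one_of_lt {x : ℝ} (hx : x < u.lo 1) : u.f x < 1 :=
  lt_of_le_of_ne (u.le_one x) fun h => hx.not_ge ((u.eq_one_iff x).1 h).1

/-- The left end of the level cut through a point of the increasing branch lies on the same
level. -/
theorem lo_apply {x : ℝ} (h0 : u.lo 0 ≤ x) (h1 : x ≤ u.lo 1) :
    u.lo 0 ≤ u.lo (u.f x) ∧ u.lo (u.f x) ≤ x ∧ u.f (u.lo (u.f x)) = u.f x := by
  rcases (u.nonneg x).eq_or_lt with h | h
  · rw [← h]
    refine ⟨le_rfl, h0, le_antisymm ?_ (u.nonneg _)⟩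
    conv_rhs => rw [h]
    exact u.monotoneOn (h0.trans h1) h1 h0
  · have hx := (u.le_iff h (u.le_one x) x).1 le_rfl
    have hl := (u.le_iff h (u.le_one x) (u.lo (u.f x))).2 ⟨le_rfl, hx.1.trans hx.2⟩
    exact ⟨(u.mem_supp (h.trans_le hl)).1, hx.1,
      le_antisymm (u.monotoneOn (hx.1.trans h1) h1 hx.1) hl⟩

theorem eq_on_level {x : ℝ} (h0 : u.lo 0 ≤ x) (h1 : x ≤ u.lo 1) :
    ∀ y ∈ Icc (u.lo (u.f x)) x, u.f y = u.f x := by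
  intro y hy
  obtain ⟨-, -, h⟩ := u.lo_apply h0 h1
  have hy1 : y ≤ u.lo 1 := hy.2.trans h1
  exact le_antisymm (u.monotoneOn hy1 h1 hy.2)
    (h ▸ u.monotoneOn (hy.1.trans hy1) hy1 hy.1)

theorem conv_bddAbove (x : ℝ) : BddAbove (range fun y => min (u.f y) (w.f (x - y))) :=
  ⟨1, by rintro _ ⟨y, rfl⟩; exact min_le_of_left_le (u.le_one y)⟩

theorem min_le_conv_s14 (y z : ℝ) : min (u.f y) (w.f z) ≤ u.conv w (y + z) := by
  have := le_ciSup (u.conv_bddAbove w (y + z)) y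
  rwa [add_sub_cancel_left] at this

theorem conv_le_max {y z : ℝ} (hy : y ≤ u.lo 1) (hz : z ≤ w.lo 1) :
    u.conv w (y + z) ≤ max (u.f y) (w.f z) := by
  refine ciSup_le fun y' => ?_
  rcases le_total y' y with h | h
  · exact le_max_of_le_left (min_le_of_left_le (u.monotoneOn (le_trans h hy) hy h))
  · have h' : y + z - y' ≤ z := by linarith
    exact le_max_of_le_right (min_le_of_right_le (w.monotoneOn (le_trans h' hz) hz h'))

theorem conv_eq {y z : ℝ} (hy : y ≤ u.lo 1) (hz : z ≤ w.lo 1) (h : u.f y = w.f z) :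
    u.conv w (y + z) = u.f y := by
  have h1 := u.min_le_conv_s14 w y z
  have h2 := u.conv_le_max w hy hz
  rw [← h, min_self] at h1
  rw [← h, max_self] at h2
  exact le_antisymm h2 h1

theorem conv_comm : u.conv w = w.conv u := by
  funext x
  unfold conv
  rw [← (Equiv.subLeft x).iSup_comp]
  simp [min_comm]

theorem conv_eq_one {x : ℝ} (h0 : u.lo 1 + w.lo 1 ≤ x) (h1 : x ≤ u.hi 1 + w.hi 1) :
    u.conv w x = 1 := by
  refine le_antisymm (ciSup_le fun y => min_le_of_left_le (u.le_one y)) ?_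
  obtain ⟨y, z, hy, hz, rfl⟩ : ∃ y z, y ∈ Icc (u.lo 1) (u.hi 1) ∧
      z ∈ Icc (w.lo 1) (w.hi 1) ∧ y + z = x := by
    have hu := u.lo_one_le_hi_one
    have hw := w.lo_one_le_hi_one
    rcases le_total x (u.hi 1 + w.lo 1) with h | h
    · exact ⟨x - w.lo 1, w.lo 1, ⟨by linarith, by linarith⟩, ⟨le_rfl, hw⟩, by ring⟩
    · exact ⟨u.hi 1, x - u.hi 1, ⟨hu, le_rfl⟩, ⟨by linarith, by linarith⟩, by ring⟩
  have := u.min_le_conv_s14 w y z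
  rwa [(u.eq_one_iff y).2 hy, (w.eq_one_iff z).2 hz, min_self] at this

theorem exists_add_eq (huC : ContinuousOn u.f (Icc (u.lo 0) (u.hi 0)))
    (hwC : ContinuousOn w.f (Icc (w.lo 0) (w.hi 0))) (hl : w.f (w.lo 0) = u.f (u.lo 0))
    {x : ℝ} (h0 : u.lo 0 + w.lo 0 ≤ x) (h1 : x ≤ u.lo 1 + w.lo 1) :
    ∃ y z, y ∈ Icc (u.lo 0) (u.lo 1) ∧ z ∈ Icc (w.lo 0) (w.lo 1) ∧ y + z = x ∧
      u.f y = w.f z := by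
  have hu := u.lo_zero_le_lo_one
  have hw := w.lo_zero_le_lo_one
  have hu' := u.lo_one_le_hi_zero
  have hw' := w.lo_one_le_hi_zero
  set p := max (u.lo 0) (x - w.lo 1) with hp
  set q := min (u.lo 1) (x - w.lo 0) with hq
  have hp1 : u.lo 0 ≤ p := le_max_left _ _
  have hp2 : x - w.lo 1 ≤ p := le_max_right _ _
  have hq1 : q ≤ u.lo 1 := min_le_left _ _
  have hq2 : q ≤ x - w.lo 0 := min_le_right _ _
  have hpq : p ≤ q := by
    apply max_le <;> apply le_min <;> linarith
  have hc : ContinuousOn (fun y => u.f y - w.f (x - y)) (Icc p q) := by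
    refine (huC.mono fun y hy => ⟨by linarith [hy.1], by linarith [hy.2]⟩).sub
      (hwC.comp (by fun_prop) fun y hy => ⟨by linarith [hy.2], by linarith [hy.1]⟩)
  have hbu : ∀ y, u.lo 0 ≤ y → y ≤ u.lo 1 → u.f (u.lo 0) ≤ u.f y :=
    fun y h h' => u.monotoneOn hu h' h
  have hbw : ∀ y, w.lo 0 ≤ y → y ≤ w.lo 1 → w.f (w.lo 0) ≤ w.f y :=
    fun y h h' => w.monotoneOn hw h' h
  have hdp : u.f p - w.f (x - p) ≤ 0 := by
    rcases max_choice (u.lo 0) (x - w.lo 1) with h | h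
    · rw [← hp] at h
      have := hbw (x - p) (by linarith) (by linarith)
      rw [h] at this ⊢
      linarith
    · rw [← hp] at h
      rw [h, sub_sub_cancel, w.lo_one]
      linarith [u.le_one (x - w.lo 1)]
  have hdq : 0 ≤ u.f q - w.f (x - q) := by
    rcases min_choice (u.lo 1) (x - w.lo 0) with h | h
    · rw [← hq] at h
      rw [h, u.lo_one]
      linarith [w.le_one (x - u.lo 1)]
    · rw [← hq] at h
      have := hbu q (by linarith) (by linarith)
      rw [h] at this ⊢
      rw [sub_sub_cancel]
      linarith
  obtain ⟨y, hy, hy0⟩ := intermediate_value_Icc hpq hc ⟨hdp, hdq⟩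
  exact ⟨y, x - y, ⟨by linarith [hy.1], by linarith [hy.2]⟩,
    ⟨by linarith [hy.2], by linarith [hy.1]⟩, by ring, sub_eq_zero.1 hy0⟩

theorem hasDerivWithinAt_conv_zero {y z : ℝ} {s : Set ℝ} (hy : y ≤ u.lo 1) (hz : z ≤ w.lo 1)
    (h : u.f y = w.f z) (hs : ∀ᶠ z' in 𝓝[s] z, z' ≤ w.lo 1)
    (hd : HasDerivWithinAt w.f 0 s z) :
    HasDerivWithinAt (u.conv w) 0 ((fun x => x - y) ⁻¹' s) (y + z) := by
  have hmaps : MapsTo (fun x => x - y) ((fun x => x - y) ⁻¹' s) s := fun x hx => hx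
  have hd' : HasDerivWithinAt w.f 0 s ((y + z) - y) := by rwa [add_sub_cancel_left]
  have hB := hd'.comp (y + z) ((hasDerivAt_id (y + z)).sub_const y).hasDerivWithinAt hmaps
  simp only [zero_mul] at hB
  refine (hasDerivWithinAt_const (y + z) _ (u.f y)).of_min_le_of_le_max hB ?_ ?_ ?_
  · rw [u.conv_eq w hy hz h]
  · simp [u.conv_eq w hy hz h, h]
  · have ht : Tendsto (fun x => x - y) (𝓝[(fun x => x - y) ⁻¹' s] (y + z)) (𝓝[s] z) := by
      have : ContinuousWithinAt (fun x => x - y) ((fun x => x - y) ⁻¹' s) (y + z) := by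
        fun_prop
      simpa using this.tendsto_nhdsWithin hmaps
    filter_upwards [ht.eventually hs] with x hx
    have h1 := u.min_le_conv_s14 w y (x - y)
    have h2 := u.conv_le_max w hy hx
    rw [add_sub_cancel] at h1 h2
    exact ⟨h1, h2⟩

theorem differentiableAt_conv_of_right {y z : ℝ} (hy : y ≤ u.lo 1) (hz : z < w.lo 1)
    (h : u.f y = w.f z) (hd : HasDerivAt w.f 0 z) :
    DifferentiableAt ℝ (u.conv w) (y + z) := by
  have := u.hasDerivWithinAt_conv_zero w hy hz.le h (s := univ)
    (by rw [nhdsWithin_univ]; filter_upwards [Iio_mem_nhds hz] with a ha using le_of_lt ha)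
    hd.hasDerivWithinAt
  rw [preimage_univ, hasDerivWithinAt_univ] at this
  exact this.differentiableAt

theorem deriv_nonneg_of_lt {y p : ℝ} (hy : y < u.lo 1) (hd : HasDerivAt u.f p y) : 0 ≤ p := by
  refine (hd.hasDerivWithinAt (s := Iic y)).nonneg_of_monotoneOn ?_
    (u.monotoneOn.mono (Iic_subset_Iic.2 hy.le))
  exact (uniqueDiffWithinAt_Iic y).accPt

theorem differentiableAt_conv_of_both {y z : ℝ} (hy : y < u.lo 1) (hz : z < w.lo 1)
    (h : u.f y = w.f z) (hu : DifferentiableAt ℝ u.f y) (hw : DifferentiableAt ℝ w.f z) :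
    DifferentiableAt ℝ (u.conv w) (y + z) := by
  have hu := hu.hasDerivAt
  have hw := hw.hasDerivAt
  set p := deriv u.f y
  set q := deriv w.f z
  have hp : 0 ≤ p := u.deriv_nonneg_of_lt hy hu
  have hq : 0 ≤ q := w.deriv_nonneg_of_lt hz hw
  rcases hq.eq_or_lt with hq0 | hq0
  · exact u.differentiableAt_conv_of_right w hy.le hz h (hq0 ▸ hw)
  have hpq : p + q ≠ 0 := by positivity
  set t := q / (p + q) with ht
  set Y := fun x : ℝ => y + t * (x - (y + z)) with hY
  set Z := fun x : ℝ => z + (1 - t) * (x - (y + z)) with hZ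
  have hY0 : Y (y + z) = y := by simp [hY]
  have hZ0 : Z (y + z) = z := by simp [hZ]
  have hYd : HasDerivAt Y t (y + z) := by
    simpa only [mul_one] using
      (((hasDerivAt_id' (y + z)).sub_const (y + z)).const_mul t).const_add y
  have hZd : HasDerivAt Z (1 - t) (y + z) := by
    simpa only [mul_one] using
      (((hasDerivAt_id' (y + z)).sub_const (y + z)).const_mul (1 - t)).const_add z
  have hA := HasDerivAt.comp (y + z) (by rwa [hY0]) hYd (h₂ := u.f) (h₂' := p)
  have hB := HasDerivAt.comp (y + z) (by rwa [hZ0]) hZd (h₂ := w.f) (h₂' := q)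
  have hpt : q * (1 - t) = p * t := by rw [ht]; field_simp; ring
  rw [hpt] at hB
  have hV := u.conv_eq w hy.le hz.le h
  have := hA.hasDerivWithinAt.of_min_le_of_le_max (s := univ) (V := u.conv w)
    hB.hasDerivWithinAt (by simp [hY0, hV]) (by simp [hZ0, hV, h]) (by
      rw [nhdsWithin_univ]
      have h1 := hYd.continuousAt.eventually_lt_const (by rwa [hY0])
      have h2 := hZd.continuousAt.eventually_lt_const (by rwa [hZ0])
      filter_upwards [h1, h2] with x hx1 hx2
      have h1 := u.min_le_conv_s14 w (Y x) (Z x)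
      have h2 := u.conv_le_max w hx1.le hx2.le
      have h3 : Y x + Z x = x := by simp only [hY, hZ]; ring
      rw [h3] at h1 h2
      exact ⟨h1, h2⟩)
  exact (hasDerivWithinAt_univ.1 this).differentiableAt

theorem differentiableAt_conv_of_mem_left
    (huC : ContinuousOn u.f (Icc (u.lo 0) (u.hi 0)))
    (hwC : ContinuousOn w.f (Icc (w.lo 0) (w.hi 0)))
    (hwD : ∀ x ∈ Ioo (w.lo 0) (w.hi 0), DifferentiableAt ℝ w.f x)
    (hl : w.f (w.lo 0) = u.f (u.lo 0))
    (h4 : ∀ x ∈ Ioo (u.lo 0) (u.lo 1), ¬ DifferentiableAt ℝ u.f x →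
      HasDerivWithinAt w.f 0 (Ioi (w.lo (u.f x))) (w.lo (u.f x)))
    {x : ℝ} (hx : x ∈ Ioo (u.lo 0 + w.lo 0) (u.lo 1 + w.lo 1)) :
    DifferentiableAt ℝ (u.conv w) x := by
  obtain ⟨y, z, hy, hz, rfl, h⟩ := u.exists_add_eq w huC hwC hl hx.1.le hx.2.le
  have hyz : y < u.lo 1 ∧ z < w.lo 1 := by
    constructor
    · refine lt_of_le_of_ne hy.2 fun e => ?_
      rw [e, u.lo_one] at h
      linarith [hx.2, ((w.eq_one_iff z).1 h.symm).1]
    · refine lt_of_le_of_ne hz.2 fun e => ?_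
      rw [e, w.lo_one] at h
      linarith [hx.2, ((u.eq_one_iff y).1 h).1]
  obtain ⟨hy1, hz1⟩ := hyz
  have hmu := u.lo_zero_le_lo_one
  have hmw := w.lo_zero_le_lo_one
  have hlev := w.eq_on_level hz.1 hz1.le
  obtain ⟨hl0, hlz, -⟩ := w.lo_apply hz.1 hz1.le
  rcases hz.1.eq_or_lt with hz0 | hz0
  · have hy0 : u.lo 0 < y := by linarith [hx.1]
    have hconst : ∀ y' ∈ Icc (u.lo 0) y, u.f y' = u.f y := by
      intro y' hy'
      have h' : y' ≤ u.lo 1 := hy'.2.trans hy1.le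
      refine le_antisymm (u.monotoneOn h' hy1.le hy'.2) ?_
      rw [h, ← hz0, hl]
      exact u.monotoneOn hmu h' hy'.1
    have hleft := hasDerivWithinAt_Iic_zero_of_const hy0 hconst
    by_cases hud : DifferentiableAt ℝ u.f y
    · have := hud.hasDerivAt_zero_of_hasDerivWithinAt (uniqueDiffWithinAt_Iic y) hleft
      rw [u.conv_comm w, add_comm]
      exact w.differentiableAt_conv_of_right u hz.2 hy1 h.symm this
    · have hr := h4 y ⟨hy0, hy1⟩ hud
      have hlo : w.lo (u.f y) = z := by
        rw [h]
        exact le_antisymm hlz (hz0 ▸ hl0)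
      rw [hlo] at hr
      have h1 := u.hasDerivWithinAt_conv_zero w hy.2 hz.2 h
        (mem_nhdsWithin_of_mem_nhds (by
          filter_upwards [Iio_mem_nhds hz1] with a ha using le_of_lt ha)) hr.Ici_of_Ioi
      have h2 := w.hasDerivWithinAt_conv_zero u hz.2 hy.2 h.symm
        (mem_nhdsWithin_of_mem_nhds (by
          filter_upwards [Iio_mem_nhds hy1] with a ha using le_of_lt ha)) hleft
      rw [w.conv_comm u, add_comm] at h2
      have h3 := h1.union h2
      have hun : ((fun x => x - y) ⁻¹' Ici z ∪ (fun x => x - z) ⁻¹' Iic y) = univ := by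
        ext x
        simp only [mem_union, mem_preimage, mem_Ici, mem_Iic, mem_univ, iff_true]
        rcases le_total z (x - y) with h | h
        · exact Or.inl h
        · right; linarith
      rw [hun, hasDerivWithinAt_univ] at h3
      exact h3.differentiableAt
  · have hwd : DifferentiableAt ℝ w.f z := hwD z ⟨hz0, hz1.trans_le w.lo_one_le_hi_zero⟩
    by_cases hud : DifferentiableAt ℝ u.f y
    · exact u.differentiableAt_conv_of_both w hy1 hz1 h hud hwd
    · refine u.differentiableAt_conv_of_right w hy.2 hz1 h ?_
      rcases hlz.eq_or_lt with hlo | hlo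
      · have hy0 : u.lo 0 < y := by
          refine lt_of_le_of_ne hy.1 fun e => ?_
          have h1 := (w.lo_apply le_rfl hmw).2.1
          rw [hl, e, h, hlo] at h1
          linarith
        have hr := h4 y ⟨hy0, hy1⟩ hud
        rw [h, hlo] at hr
        exact hwd.hasDerivAt_zero_of_hasDerivWithinAt (uniqueDiffWithinAt_Ioi z) hr
      · exact hwd.hasDerivAt_zero_of_hasDerivWithinAt (uniqueDiffWithinAt_Iic z)
          (hasDerivWithinAt_Iic_zero_of_const hlo hlev)

theorem lo_zero_lt_lo_one (hl : w.f (w.lo 0) = u.f (u.lo 0))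
    (h : u.lo 0 + w.lo 0 < u.lo 1 + w.lo 1) : u.lo 0 < u.lo 1 := by
  refine lt_of_le_of_ne u.lo_zero_le_lo_one fun e => ?_
  rw [e, u.lo_one] at hl
  linarith [((w.eq_one_iff _).1 hl).1]

theorem hasDerivWithinAt_Iic_conv_zero {y z : ℝ} (hy : y ≤ u.lo 1) (hz : z ≤ w.lo 1)
    (h : u.f y = w.f z) (hd : HasDerivWithinAt w.f 0 (Iic z) z) :
    HasDerivWithinAt (u.conv w) 0 (Iic (y + z)) (y + z) := by
  have := u.hasDerivWithinAt_conv_zero w hy hz h (s := Iic z)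
    (by filter_upwards [self_mem_nhdsWithin] with a ha using le_trans ha hz) hd
  convert this using 1
  ext x
  simp [add_comm]

theorem hasDerivAt_lo_one (hd : DifferentiableAt ℝ u.f (u.lo 1)) :
    HasDerivAt u.f 0 (u.lo 1) := by
  have hm : IsLocalMax u.f (u.lo 1) :=
    Eventually.of_forall fun x => by rw [u.lo_one]; exact u.le_one x
  exact hm.hasDerivAt_eq_zero hd.hasDerivAt ▸ hd.hasDerivAt

theorem hasDerivWithinAt_Iic_conv_of_mem_core
    (hwD : ∀ x ∈ Ioo (w.lo 0) (w.hi 0), DifferentiableAt ℝ w.f x)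
    (hl : w.f (w.lo 0) = u.f (u.lo 0))
    (hcore : u.lo 1 ∈ Ioo (u.lo 0) (u.hi 0) → ¬ DifferentiableAt ℝ u.f (u.lo 1) →
      HasDerivWithinAt w.f 0 (Iio (w.lo 1)) (w.lo 1))
    {x : ℝ} (hx : x ∈ Ioo (u.lo 0 + w.lo 0) (u.hi 0 + w.hi 0))
    (hx1 : x ∈ Icc (u.lo 1 + w.lo 1) (u.hi 1 + w.hi 1)) :
    HasDerivWithinAt (u.conv w) 0 (Iic x) x := by
  rcases hx1.1.eq_or_lt with rfl | h
  · have hu := u.lo_zero_lt_lo_one w hl hx.1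
    have hw : w.lo 0 < w.lo 1 :=
      w.lo_zero_lt_lo_one u hl.symm (by linarith [hx.1])
    have heq : u.f (u.lo 1) = w.f (w.lo 1) := by rw [u.lo_one, w.lo_one]
    rcases w.lo_one_le_hi_zero.lt_or_eq with h | h
    · exact u.hasDerivWithinAt_Iic_conv_zero w le_rfl le_rfl heq
        (w.hasDerivAt_lo_one (hwD _ ⟨hw, h⟩)).hasDerivWithinAt
    · have hu' : u.lo 1 < u.hi 0 := by linarith [hx.2]
      by_cases hud : DifferentiableAt ℝ u.f (u.lo 1)
      · rw [u.conv_comm, add_comm]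
        exact w.hasDerivWithinAt_Iic_conv_zero u le_rfl le_rfl heq.symm
          (u.hasDerivAt_lo_one hud).hasDerivWithinAt
      · exact u.hasDerivWithinAt_Iic_conv_zero w le_rfl le_rfl heq
          (hcore ⟨hu, hu'⟩ hud).Iic_of_Iio
  · refine hasDerivWithinAt_Iic_zero_of_const h fun y hy => ?_
    rw [u.conv_eq_one w hx1.1 hx1.2, u.conv_eq_one w hy.1 (hy.2.trans hx1.2)]

theorem continuousOn_conv_left
    (huC : ContinuousOn u.f (Icc (u.lo 0) (u.hi 0)))
    (hwC : ContinuousOn w.f (Icc (w.lo 0) (w.hi 0)))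
    (hl : w.f (w.lo 0) = u.f (u.lo 0))
    (hd : ∀ x ∈ Ioo (u.lo 0 + w.lo 0) (u.lo 1 + w.lo 1), DifferentiableAt ℝ (u.conv w) x) :
    ContinuousOn (u.conv w) (Icc (u.lo 0 + w.lo 0) (u.lo 1 + w.lo 1)) := by
  have hu := u.lo_zero_le_lo_one
  have hw := w.lo_zero_le_lo_one
  rcases (add_le_add hu hw).eq_or_lt with h | h
  · rw [← h, Icc_self]
    exact continuousOn_singleton _ _
  set a := u.lo 0 + w.lo 0 with ha
  set b := u.lo 1 + w.lo 1 with hb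
  set t := (u.lo 1 - u.lo 0) / (b - a) with ht
  have hba : 0 < b - a := sub_pos.2 h
  have ht0 : 0 ≤ t := div_nonneg (sub_nonneg.2 hu) hba.le
  have htb : t * (b - a) = u.lo 1 - u.lo 0 := div_mul_cancel₀ _ hba.ne'
  have htb' : (1 - t) * (b - a) = w.lo 1 - w.lo 0 := by rw [sub_mul, htb, hb, ha]; ring
  have ht1 : 0 ≤ 1 - t := by
    refine nonneg_of_mul_nonneg_left ?_ hba
    rw [htb']
    exact sub_nonneg.2 hw
  set Y := fun x : ℝ => u.lo 0 + t * (x - a) with hY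
  set Z := fun x : ℝ => w.lo 0 + (1 - t) * (x - a) with hZ
  have hYZ : ∀ x, Y x + Z x = x := fun x => by simp only [hY, hZ, ha]; ring
  have hYm : MapsTo Y (Icc a b) (Icc (u.lo 0) (u.lo 1)) := fun x hx => by
    have h1 := mul_nonneg ht0 (sub_nonneg.2 hx.1)
    have h2 := mul_le_mul_of_nonneg_left (sub_le_sub_right hx.2 a) ht0
    simp only [hY]
    constructor <;> linarith
  have hZm : MapsTo Z (Icc a b) (Icc (w.lo 0) (w.lo 1)) := fun x hx => by
    have h1 := mul_nonneg ht1 (sub_nonneg.2 hx.1)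
    have h2 := mul_le_mul_of_nonneg_left (sub_le_sub_right hx.2 a) ht1
    simp only [hZ]
    constructor <;> linarith
  have hA : ContinuousOn (fun x => u.f (Y x)) (Icc a b) :=
    (huC.mono (Icc_subset_Icc_right u.lo_one_le_hi_zero)).comp (by fun_prop) hYm
  have hB : ContinuousOn (fun x => w.f (Z x)) (Icc a b) :=
    (hwC.mono (Icc_subset_Icc_right w.lo_one_le_hi_zero)).comp (by fun_prop) hZm
  have key : ∀ x ∈ Icc a b, u.f (Y x) = w.f (Z x) →
      ContinuousWithinAt (u.conv w) (Icc a b) x := by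
    intro x hx he
    have hV := u.conv_eq w (hYm hx).2 (hZm hx).2 he
    rw [hYZ] at hV
    have h1 := (hA x hx).min (hB x hx)
    have h2 := (hA x hx).max (hB x hx)
    simp only [← he, min_self, max_self, ← hV] at h1 h2
    refine tendsto_of_tendsto_of_tendsto_of_le_of_le' h1 h2 ?_ ?_
    · filter_upwards with x'
      have := u.min_le_conv_s14 w (Y x') (Z x')
      rwa [hYZ] at this
    · filter_upwards [self_mem_nhdsWithin] with x' hx'
      have := u.conv_le_max w (hYm hx').2 (hZm hx').2
      rwa [hYZ] at this
  intro x hx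
  rcases hx.1.eq_or_lt with h1 | h1
  · refine key x hx ?_
    simp [hY, hZ, ← h1, hl]
  rcases hx.2.eq_or_lt with h2 | h2
  · refine key x hx ?_
    have e1 : Y x = u.lo 1 := by simp only [hY, h2]; linarith
    have e2 : Z x = w.lo 1 := by simp only [hZ, h2]; linarith
    rw [e1, e2, u.lo_one, w.lo_one]
  · exact (hd x ⟨h1, h2⟩).continuousAt.continuousWithinAt

/-- The reflection `x ↦ u (-x)` of a fuzzy number. -/
def reflect : FuzzyNumber where
  f x := u.f (-x)
  mem_Icc x := u.mem_Icc (-x)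
  cut_isIcc α hα := by
    obtain ⟨a, b, hab, h⟩ := u.cut_isIcc α hα
    refine ⟨-b, -a, neg_le_neg hab, ?_⟩
    have : {x | α ≤ u.f (-x)} = -{x | α ≤ u.f x} := rfl
    rw [this, h, neg_Icc]
  supp_isIcc := by
    obtain ⟨a, b, hab, h⟩ := u.supp_isIcc
    refine ⟨-b, -a, neg_le_neg hab, ?_⟩
    have : {x | 0 < u.f (-x)} = Homeomorph.neg ℝ ⁻¹' {x | 0 < u.f x} := rfl
    rw [this, ← Homeomorph.preimage_closure, h, ← neg_Icc]
    rfl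

theorem reflect_f (x : ℝ) : u.reflect.f x = u.f (-x) := rfl

theorem cut_reflect (α : ℝ) : u.reflect.cut α = -u.cut α := by
  unfold cut
  split_ifs
  · have : {x | 0 < u.reflect.f x} = Homeomorph.neg ℝ ⁻¹' {x | 0 < u.f x} := rfl
    rw [this, ← Homeomorph.preimage_closure]
    rfl
  · rfl

theorem lo_reflect (α : ℝ) : u.reflect.lo α = -u.hi α := by
  rw [lo, cut_reflect, Real.sInf_neg, hi]

theorem hi_reflect (α : ℝ) : u.reflect.hi α = -u.lo α := by
  rw [hi, cut_reflect, Real.sSup_neg, lo]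

theorem conv_reflect (x : ℝ) : u.reflect.conv w.reflect x = u.conv w (-x) := by
  unfold conv
  rw [← (Equiv.neg ℝ).iSup_comp]
  congr! 3 with y
  · simp [reflect_f]
  · simp only [reflect_f, Equiv.neg_apply]
    ring_nf

theorem continuousOn_reflect (huC : ContinuousOn u.f (Icc (u.lo 0) (u.hi 0))) :
    ContinuousOn u.reflect.f (Icc (u.reflect.lo 0) (u.reflect.hi 0)) := by
  refine huC.comp continuous_neg.continuousOn fun x hx => ?_
  rw [lo_reflect, hi_reflect] at hx
  exact ⟨le_neg_of_le_neg hx.2, neg_le.1 hx.1⟩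

theorem differentiableAt_reflect {x : ℝ} :
    DifferentiableAt ℝ u.reflect.f x ↔ DifferentiableAt ℝ u.f (-x) :=
  differentiableAt_comp_neg

theorem differentiableAt_conv_of_mem_right
    (huC : ContinuousOn u.f (Icc (u.lo 0) (u.hi 0)))
    (hwC : ContinuousOn w.f (Icc (w.lo 0) (w.hi 0)))
    (hwD : ∀ x ∈ Ioo (w.lo 0) (w.hi 0), DifferentiableAt ℝ w.f x)
    (hr : w.f (w.hi 0) = u.f (u.hi 0))
    (h4 : ∀ x ∈ Ioo (u.hi 1) (u.hi 0), ¬ DifferentiableAt ℝ u.f x →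
      HasDerivWithinAt w.f 0 (Iio (w.hi (u.f x))) (w.hi (u.f x)))
    {x : ℝ} (hx : x ∈ Ioo (u.hi 1 + w.hi 1) (u.hi 0 + w.hi 0)) :
    DifferentiableAt ℝ (u.conv w) x := by
  have := u.reflect.differentiableAt_conv_of_mem_left w.reflect (u.continuousOn_reflect huC)
    (w.continuousOn_reflect hwC)
    (fun x hx => by
      rw [lo_reflect, hi_reflect] at hx
      exact w.differentiableAt_reflect.2 (hwD _ ⟨lt_neg_of_lt_neg hx.2, neg_lt.1 hx.1⟩))
    (by simpa [lo_reflect, reflect_f] using hr)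
    (fun x hx hd => by
      simp only [lo_reflect] at hx ⊢
      rw [differentiableAt_reflect] at hd
      exact (h4 (-x) ⟨lt_neg_of_lt_neg hx.2, neg_lt.1 hx.1⟩ hd).comp_neg_Ioi)
    (x := -x) (by simp only [lo_reflect, mem_Ioo]; constructor <;> linarith [hx.1, hx.2])
  rw [funext (u.conv_reflect w)] at this
  simpa using differentiableAt_comp_neg.1 this

theorem hasDerivWithinAt_Ici_conv_of_mem_core
    (hwD : ∀ x ∈ Ioo (w.lo 0) (w.hi 0), DifferentiableAt ℝ w.f x)
    (hr : w.f (w.hi 0) = u.f (u.hi 0))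
    (hcore : u.hi 1 ∈ Ioo (u.lo 0) (u.hi 0) → ¬ DifferentiableAt ℝ u.f (u.hi 1) →
      HasDerivWithinAt w.f 0 (Ioi (w.hi 1)) (w.hi 1))
    {x : ℝ} (hx : x ∈ Ioo (u.lo 0 + w.lo 0) (u.hi 0 + w.hi 0))
    (hx1 : x ∈ Icc (u.lo 1 + w.lo 1) (u.hi 1 + w.hi 1)) :
    HasDerivWithinAt (u.conv w) 0 (Ici x) x := by
  have := u.reflect.hasDerivWithinAt_Iic_conv_of_mem_core w.reflect
    (fun x hx => by
      rw [lo_reflect, hi_reflect] at hx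
      exact w.differentiableAt_reflect.2 (hwD _ ⟨lt_neg_of_lt_neg hx.2, neg_lt.1 hx.1⟩))
    (by simpa [lo_reflect, reflect_f] using hr)
    (fun hx hd => by
      simp only [lo_reflect, hi_reflect, differentiableAt_reflect, neg_neg] at hx hd ⊢
      exact (hcore ⟨neg_lt_neg_iff.1 hx.2, neg_lt_neg_iff.1 hx.1⟩ hd).comp_neg_Iio)
    (x := -x)
    (by simp only [lo_reflect, hi_reflect, mem_Ioo]; constructor <;> linarith [hx.1, hx.2])
    (by simp only [lo_reflect, hi_reflect]; constructor <;> linarith [hx1.1, hx1.2])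
  have := this.Iio_of_Iic.comp_neg_Ioi
  simp only [conv_reflect, neg_neg] at this
  exact this.Ici_of_Ioi

theorem continuousOn_conv_right
    (huC : ContinuousOn u.f (Icc (u.lo 0) (u.hi 0)))
    (hwC : ContinuousOn w.f (Icc (w.lo 0) (w.hi 0)))
    (hr : w.f (w.hi 0) = u.f (u.hi 0))
    (hd : ∀ x ∈ Ioo (u.hi 1 + w.hi 1) (u.hi 0 + w.hi 0), DifferentiableAt ℝ (u.conv w) x) :
    ContinuousOn (u.conv w) (Icc (u.hi 1 + w.hi 1) (u.hi 0 + w.hi 0)) := by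
  have := u.reflect.continuousOn_conv_left w.reflect (u.continuousOn_reflect huC)
    (w.continuousOn_reflect hwC) (by simpa [lo_reflect, reflect_f] using hr)
    (fun x hx => by
      simp only [lo_reflect, mem_Ioo] at hx
      rw [funext (u.conv_reflect w)]
      exact differentiableAt_comp_neg.2 (hd (-x) ⟨by linarith, by linarith⟩))
  have h := this.comp continuous_neg.continuousOn
    (s := Icc (u.hi 1 + w.hi 1) (u.hi 0 + w.hi 0)) (fun x hx => by
      simp only [lo_reflect]
      constructor <;> linarith [hx.1, hx.2])
  refine h.congr fun x _ => ?_
  simp [conv_reflect]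

end FuzzyNumber

/-- Theorem `rndp`: if `u ∈ F_C(ℝ)`, `w ∈ F_D(ℝ)` and `w`
satisfies conditions (i), (ii) and (iv), then `u∇w ∈ F_D(ℝ)`. -/
theorem conv_memFD_of_memFC (u w : FuzzyNumber)
    -- `u ∈ F_C(ℝ)`
    (huC : ContinuousOn u.f (Set.Icc (u.lo 0) (u.hi 0)))
    -- `w ∈ F_D(ℝ)`
    (hwC : ContinuousOn w.f (Set.Icc (w.lo 0) (w.hi 0)))
    (hwD : ∀ x ∈ Set.Ioo (w.lo 0) (w.hi 0), DifferentiableAt ℝ w.f x)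
    -- condition (i)
    (h1l : w.f (w.lo 0) = u.f (u.lo 0)) (h1r : w.f (w.hi 0) = u.f (u.hi 0))
    -- condition (ii-1)
    (h21 : u.lo 1 ∈ Set.Ioo (u.lo 0) (u.hi 0) → ¬ DifferentiableAt ℝ u.f (u.lo 1) →
      HasLeftDerivAt w.f 0 (w.lo 1))
    -- condition (ii-2)
    (h22 : u.hi 1 ∈ Set.Ioo (u.lo 0) (u.hi 0) → ¬ DifferentiableAt ℝ u.f (u.hi 1) →
      HasRightDerivAt w.f 0 (w.hi 1))
    -- condition (iv)
    (h4 : ∀ x ∈ Set.Ioo (u.lo 0) (u.hi 0), ¬ DifferentiableAt ℝ u.f x →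
      (x ∈ Set.Ioo (u.lo 0) (u.lo 1) → HasRightDerivAt w.f 0 (w.lo (u.f x))) ∧
      (x ∈ Set.Ioo (u.hi 1) (u.hi 0) → HasLeftDerivAt w.f 0 (w.hi (u.f x)))) :
    -- conclusion: `u∇w ∈ F_D(ℝ)`
    ContinuousOn (u.conv w) (Set.Icc (u.lo 0 + w.lo 0) (u.hi 0 + w.hi 0)) ∧
    ∀ x ∈ Set.Ioo (u.lo 0 + w.lo 0) (u.hi 0 + w.hi 0),
      DifferentiableAt ℝ (u.conv w) x := by
  have hL : ∀ x ∈ Ioo (u.lo 0 + w.lo 0) (u.lo 1 + w.lo 1), DifferentiableAt ℝ (u.conv w) x :=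
    fun x hx => u.differentiableAt_conv_of_mem_left w huC hwC hwD h1l
      (fun y hy hd => (h4 y ⟨hy.1, hy.2.trans_le u.lo_one_le_hi_zero⟩ hd).1 hy) hx
  have hR : ∀ x ∈ Ioo (u.hi 1 + w.hi 1) (u.hi 0 + w.hi 0), DifferentiableAt ℝ (u.conv w) x :=
    fun x hx => u.differentiableAt_conv_of_mem_right w huC hwC hwD h1r
      (fun y hy hd => (h4 y ⟨(u.lo_zero_le_lo_one.trans u.lo_one_le_hi_one).trans_lt hy.1,
        hy.2⟩ hd).2 hy) hx
  constructor
  · have hM : ContinuousOn (u.conv w) (Icc (u.lo 1 + w.lo 1) (u.hi 1 + w.hi 1)) :=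
      continuousOn_const.congr fun x hx => u.conv_eq_one w hx.1 hx.2
    have h := ((u.continuousOn_conv_left w huC hwC h1l hL).union_of_isClosed hM isClosed_Icc
      isClosed_Icc).union_of_isClosed (u.continuousOn_conv_right w huC hwC h1r hR)
      (isClosed_Icc.union isClosed_Icc) isClosed_Icc
    refine h.mono fun x hx => ?_
    rcases le_total x (u.lo 1 + w.lo 1) with h1 | h1
    · exact Or.inl (Or.inl ⟨hx.1, h1⟩)
    rcases le_total x (u.hi 1 + w.hi 1) with h2 | h2
    · exact Or.inl (Or.inr ⟨h1, h2⟩)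
    · exact Or.inr ⟨h2, hx.2⟩
  · intro x hx
    rcases lt_or_ge x (u.lo 1 + w.lo 1) with h1 | h1
    · exact hL x ⟨hx.1, h1⟩
    rcases lt_or_ge (u.hi 1 + w.hi 1) x with h2 | h2
    · exact hR x ⟨h2, hx.2⟩
    have h := (u.hasDerivWithinAt_Iic_conv_of_mem_core w hwD h1l h21 hx ⟨h1, h2⟩).union
      (u.hasDerivWithinAt_Ici_conv_of_mem_core w hwD h1r h22 hx ⟨h1, h2⟩)
    rw [Iic_union_Ici, hasDerivWithinAt_univ] at h
    exact h.differentiableAt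
end
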